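/- Let (X,𝒞) be an RX3C instance with |X| = 3κ, κ ≥ 1, and let r ≥ 3 be an integer. Let P = {p_1, …, p_{r+1}} be a set of r+1 candidates disjoint from X. Consider the approval election with candidate set C = X ∪ P whose votes are: one vote equal to P, and for each H ∈ 𝒞 one vote equal to H. Then it is possible to select at most κ+1 votes and replace each selected vote v by a vote v' with v' ⊆ v and |v∖v'| ≤ r, so that in the resulting election no candidate of X belongs to any winning 1-committee under SAV, if and only if 𝒞 contains an exact cover of X. -/

import Mathlib

namespace ApprovalBribery

variable {α : Type*} [DecidableEq α]

/-- AV score of a candidate: number of votes approving it. -/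
def avScore (V : Multiset (Finset α)) (c : α) : ℕ :=
  (V.map fun v => if c ∈ v then 1 else 0).sum

/-- AV score of a committee. -/
def avCom (V : Multiset (Finset α)) (w : Finset α) : ℕ :=
  (V.map fun v => (v ∩ w).card).sum

/-- SAV score of a candidate. -/
def savScore (V : Multiset (Finset α)) (c : α) : ℚ :=
  (V.map fun v => if c ∈ v then ((v.card : ℚ))⁻¹ else 0).sum

/-- NSAV score of a candidate in an election with candidate set `C`. -/
def nsavScore (C : Finset α) (V : Multiset (Finset α)) (c : α) : ℚ :=
  savScore V c -
    (V.map fun v => if c ∉ v ∧ v ≠ C then ((C.card : ℚ) - (v.card : ℚ))⁻¹ else 0).sum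

/-- SAV score of a committee. -/
def savCom (V : Multiset (Finset α)) (w : Finset α) : ℚ :=
  (V.map fun v => ((v ∩ w).card : ℚ) / (v.card : ℚ)).sum

/-- CCAV score of a committee. -/
def ccavCom (V : Multiset (Finset α)) (w : Finset α) : ℕ :=
  (V.map fun v => if v ∩ w ≠ ∅ then 1 else 0).sum

/-- PAV score of a committee. -/
def pavCom (V : Multiset (Finset α)) (w : Finset α) : ℚ :=
  (V.map fun v => ∑ i ∈ Finset.range (v ∩ w).card, ((i : ℚ) + 1)⁻¹).sum

/-- `w` is a winning `k`-committee for the scoring function `score` in an election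
with candidate set `C`. -/
def IsWinningCommittee {β : Type*} [Preorder β] (C : Finset α) (k : ℕ)
    (score : Finset α → β) (w : Finset α) : Prop :=
  w ⊆ C ∧ w.card = k ∧ ∀ w' ⊆ C, w'.card = k → score w' ≤ score w

/-- `V'` is obtained from `V` by performing at most `ℓ` single approval additions,
each of which inserts one candidate of `C` into one vote not already containing it. -/
def ApprovalAdds (C : Finset α) (V V' : Multiset (Finset α)) (ℓ : ℕ) : Prop :=
  ∃ P : Multiset (Finset α × Finset α),
    V = P.map Prod.fst ∧ V' = P.map Prod.snd ∧
    (∀ q ∈ P, q.1 ⊆ q.2 ∧ q.2 ⊆ C) ∧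
    (P.map fun q => (q.2 \ q.1).card).sum ≤ ℓ

/-- `V'` is obtained from `V` by performing at most `ℓ` single approval deletions,
each of which removes one candidate from one vote containing it. -/
def ApprovalDels (V V' : Multiset (Finset α)) (ℓ : ℕ) : Prop :=
  ∃ P : Multiset (Finset α × Finset α),
    V = P.map Prod.fst ∧ V' = P.map Prod.snd ∧
    (∀ q ∈ P, q.2 ⊆ q.1) ∧
    (P.map fun q => (q.1 \ q.2).card).sum ≤ ℓ

/-- `V'` is obtained from `V` by selecting at most `ℓ` votes and replacing each selected
vote by an arbitrary vote over `C` within Hamming distance `r` of it. -/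
def VoteChanges (C : Finset α) (V V' : Multiset (Finset α)) (ℓ r : ℕ) : Prop :=
  ∃ P : Multiset (Finset α × Finset α),
    V = P.map Prod.fst ∧ V' = P.map Prod.snd ∧
    (∀ q ∈ P, q.1 = q.2 ∨ (q.2 ⊆ C ∧ (q.1 \ q.2).card + (q.2 \ q.1).card ≤ r)) ∧
    P.countP (fun q => q.1 ≠ q.2) ≤ ℓ

/-- `V'` is obtained from `V` by selecting at most `ℓ` votes and replacing each selected
vote `v` by a vote `v'` with `v ⊆ v' ⊆ C` and `|v' \ v| ≤ r`. -/
def VoteAdditionChanges (C : Finset α) (V V' : Multiset (Finset α)) (ℓ r : ℕ) : Prop :=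
  ∃ P : Multiset (Finset α × Finset α),
    V = P.map Prod.fst ∧ V' = P.map Prod.snd ∧
    (∀ q ∈ P, q.1 = q.2 ∨ (q.1 ⊆ q.2 ∧ q.2 ⊆ C ∧ (q.2 \ q.1).card ≤ r)) ∧
    P.countP (fun q => q.1 ≠ q.2) ≤ ℓ

/-- `V'` is obtained from `V` by selecting at most `ℓ` votes and replacing each selected
vote `v` by a vote `v'` with `v' ⊆ v` and `|v \ v'| ≤ r`. -/
def VoteDeletionChanges (V V' : Multiset (Finset α)) (ℓ r : ℕ) : Prop :=
  ∃ P : Multiset (Finset α × Finset α),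
    V = P.map Prod.fst ∧ V' = P.map Prod.snd ∧
    (∀ q ∈ P, q.1 = q.2 ∨ (q.2 ⊆ q.1 ∧ (q.1 \ q.2).card ≤ r)) ∧
    P.countP (fun q => q.1 ≠ q.2) ≤ ℓ

/-- `(X, 𝒞)` is an RX3C instance with `|X| = 3κ`: `𝒞` is a collection of `3κ` many
3-element subsets of `X` and every element of `X` belongs to exactly three members of `𝒞`. -/
def IsRX3C (X : Finset α) (𝒞 : Finset (Finset α)) (κ : ℕ) : Prop :=
  X.card = 3 * κ ∧ 𝒞.card = 3 * κ ∧ (∀ H ∈ 𝒞, H ⊆ X ∧ H.card = 3) ∧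
  ∀ x ∈ X, (𝒞.filter fun H => x ∈ H).card = 3

/-- `𝒞` contains an exact cover of `X`: a subcollection `𝒞' ⊆ 𝒞` such that every element
of `X` belongs to exactly one member of `𝒞'`. -/
def HasExactCover (X : Finset α) (𝒞 : Finset (Finset α)) : Prop :=
  ∃ 𝒞' ⊆ 𝒞, ∀ x ∈ X, (𝒞'.filter fun H => x ∈ H).card = 1


theorem exists_map_graph_of_nodup {β γ : Type*} [Nonempty γ] {Q : Multiset (β × γ)}
    (hQ : (Q.map Prod.fst).Nodup) :
    ∃ f : β → γ, Q = (Q.map Prod.fst).map fun b => (b, f b) := by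
  classical
  have hf : ∀ b, ∃ c, ∀ q ∈ Q, q.1 = b → q.2 = c := by
    intro b
    by_cases hb : ∃ q ∈ Q, q.1 = b
    · obtain ⟨q, hq, rfl⟩ := hb
      exact ⟨q.2, fun q' hq' h => congrArg Prod.snd
        (Multiset.inj_on_of_nodup_map hQ q' hq' q hq h)⟩
    · exact ⟨Classical.arbitrary γ, fun q hq h => (hb ⟨q, hq, h⟩).elim⟩
  choose f hf using hf
  refine ⟨f, ?_⟩
  rw [Multiset.map_map]
  conv_lhs => rw [← Multiset.map_id Q]
  exact Multiset.map_congr rfl fun q hq => Prod.ext rfl (hf q.1 q hq rfl)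

/-- On a set of pairwise distinct votes, a deletion bribery is a function of the votes. -/
theorem voteDeletionChanges_val_iff (S : Finset (Finset α)) (V' : Multiset (Finset α))
    (ℓ r : ℕ) :
    VoteDeletionChanges S.val V' ℓ r ↔
      ∃ f : Finset α → Finset α, V' = S.val.map f ∧
        (∀ v ∈ S, f v ⊆ v ∧ (v \ f v).card ≤ r) ∧ (S.filter fun v => v ≠ f v).card ≤ ℓ := by
  constructor
  · rintro ⟨Q, hS, rfl, hQ, hcount⟩
    obtain ⟨f, hf⟩ := exists_map_graph_of_nodup (hS ▸ S.nodup)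
    rw [← hS] at hf
    subst hf
    refine ⟨f, by simp [Multiset.map_map], fun v hv => ?_, ?_⟩
    · rcases hQ (v, f v) (Multiset.mem_map_of_mem _ hv) with h | h
      · simp only at h
        simp [← h]
      · exact h
    · rwa [Multiset.countP_map] at hcount
  · rintro ⟨f, rfl, hf, hcount⟩
    refine ⟨S.val.map fun v => (v, f v), by simp [Multiset.map_map],
      by simp [Multiset.map_map], fun q hq => ?_, ?_⟩
    · obtain ⟨v, hv, rfl⟩ := Multiset.mem_map.1 hq
      exact Or.inr (hf v hv)
    · rwa [Multiset.countP_map]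

theorem savCom_map_val_singleton (S : Finset (Finset α)) (f : Finset α → Finset α) (c : α) :
    savCom (S.val.map f) {c} = ∑ v ∈ S, if c ∈ f v then ((f v).card : ℚ)⁻¹ else 0 := by
  rw [savCom, Multiset.map_map]
  refine Finset.sum_congr rfl fun v _ => ?_
  by_cases h : c ∈ f v <;> simp [h]

theorem forall_notMem_winning_singleton_iff {β : Type*} [LinearOrder β] {X P : Finset α}
    (hP : P.Nonempty) (score : Finset α → β) :
    (∀ w, IsWinningCommittee (X ∪ P) 1 score w → ∀ x ∈ X, x ∉ w) ↔
      ∃ p ∈ P, ∀ x ∈ X, score {x} < score {p} := by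
  constructor
  · intro h
    obtain ⟨c, hc, hmax⟩ := Finset.exists_max_image (X ∪ P) (fun c => score {c})
      (hP.mono Finset.subset_union_right)
    have hwin : ∀ c' ∈ X ∪ P, score {c} ≤ score {c'} →
        IsWinningCommittee (X ∪ P) 1 score {c'} := by
      refine fun c' hc' hle => ⟨by simpa using hc', by simp, fun w hw hcard => ?_⟩
      obtain ⟨d, rfl⟩ := Finset.card_eq_one.1 hcard
      exact (hmax d (by simpa using hw)).trans hle
    have hcX : c ∉ X := fun hcX => h _ (hwin c hc le_rfl) c hcX (by simp)
    refine ⟨c, (Finset.mem_union.1 hc).resolve_left hcX, fun x hx => ?_⟩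
    by_contra! hle
    exact h _ (hwin x (Finset.mem_union_left _ hx) hle) x hx (by simp)
  · rintro ⟨p, hp, hlt⟩ w ⟨-, hcard, hw⟩ x hx hxw
    obtain ⟨d, rfl⟩ := Finset.card_eq_one.1 hcard
    obtain rfl := Finset.mem_singleton.1 hxw
    exact (hlt x hx).not_ge (hw {p} (by simp [hp]) (by simp))

theorem sum_card_filter_mem {X : Finset α} {𝒟 : Finset (Finset α)} {k : ℕ}
    (h : ∀ H ∈ 𝒟, H ⊆ X ∧ H.card = k) :
    ∑ x ∈ X, (𝒟.filter fun H => x ∈ H).card = k * 𝒟.card := by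
  simp_rw [Finset.card_filter]
  rw [Finset.sum_comm, mul_comm]
  refine Finset.sum_const_nat fun H hH => ?_
  rw [← Finset.card_filter, Finset.filter_mem_eq_inter, Finset.inter_eq_right.2 (h H hH).1,
    (h H hH).2]

theorem hasExactCover_of_cover {X : Finset α} {𝒞 𝒟 : Finset (Finset α)} {κ : ℕ}
    (hR : IsRX3C X 𝒞 κ) (hsub : 𝒟 ⊆ 𝒞) (hcard : 𝒟.card ≤ κ)
    (hcover : ∀ x ∈ X, ∃ H ∈ 𝒟, x ∈ H) : HasExactCover X 𝒞 := by
  refine ⟨𝒟, hsub, ?_⟩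
  have hge : ∀ x ∈ X, 1 ≤ (𝒟.filter fun H => x ∈ H).card := fun x hx => by
    obtain ⟨H, hH, hxH⟩ := hcover x hx
    exact Finset.card_pos.2 ⟨H, Finset.mem_filter.2 ⟨hH, hxH⟩⟩
  have hsum := sum_card_filter_mem fun H hH => hR.2.2.1 H (hsub hH)
  have hle := Finset.sum_le_sum hge
  have hX : ∑ _x ∈ X, 1 = 3 * κ := by simpa using hR.1
  intro x hx
  exact ((Finset.sum_eq_sum_iff_of_le hge).1 (by omega) x hx).symm

theorem card_of_exactCover {X : Finset α} {𝒞 𝒟 : Finset (Finset α)} {κ : ℕ}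
    (hR : IsRX3C X 𝒞 κ) (hsub : 𝒟 ⊆ 𝒞)
    (hcover : ∀ x ∈ X, (𝒟.filter fun H => x ∈ H).card = 1) : 𝒟.card = κ := by
  have hsum := sum_card_filter_mem fun H hH => hR.2.2.1 H (hsub hH)
  rw [Finset.sum_congr rfl hcover, Finset.sum_const, hR.1] at hsum
  simp at hsum
  omega

theorem hasExactCover_of_score_lt {X P : Finset α} {𝒞 : Finset (Finset α)} {κ r : ℕ}
    (hκ : 1 ≤ κ) (hr : 3 ≤ r) (hR : IsRX3C X 𝒞 κ) (hP : Disjoint X P)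
    (hPcard : P.card = r + 1) (hP𝒞 : P ∉ 𝒞) {f : Finset α → Finset α}
    (hf : ∀ v ∈ insert P 𝒞, f v ⊆ v)
    (hcount : ((insert P 𝒞).filter fun v => v ≠ f v).card ≤ κ + 1) {p : α} (hp : p ∈ P)
    (hlt : ∀ x ∈ X, savCom ((insert P 𝒞).val.map f) {x} <
      savCom ((insert P 𝒞).val.map f) {p}) : HasExactCover X 𝒞 := by
  obtain ⟨hXcard, h𝒞card, h𝒞, hthree⟩ := hR
  have hpscore : savCom ((insert P 𝒞).val.map f) {p} =
      if p ∈ f P then ((f P).card : ℚ)⁻¹ else 0 := by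
    rw [savCom_map_val_singleton, Finset.sum_insert hP𝒞, Finset.sum_eq_zero, add_zero]
    intro H hH
    exact if_neg fun h => Finset.disjoint_left.1 hP
      ((h𝒞 H hH).1 (hf H (Finset.mem_insert_of_mem hH) h)) hp
  have hxscore : ∀ x ∈ X, savCom ((insert P 𝒞).val.map f) {x} =
      ∑ H ∈ 𝒞, if x ∈ f H then ((f H).card : ℚ)⁻¹ else 0 := by
    intro x hx
    rw [savCom_map_val_singleton, Finset.sum_insert hP𝒞, if_neg, zero_add]
    exact fun h => Finset.disjoint_left.1 hP hx (hf P (Finset.mem_insert_self _ _) h)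
  have hnonneg : ∀ x, ∀ H ∈ 𝒞, (0 : ℚ) ≤ if x ∈ f H then ((f H).card : ℚ)⁻¹ else 0 := by
    intro x H _
    positivity
  have hPchanged : P ≠ f P := by
    intro hfix
    rw [← hfix, if_pos hp, hPcard] at hpscore
    have hquarter : (((r + 1 : ℕ) : ℚ))⁻¹ ≤ 1 / 4 := by
      rw [one_div]
      exact inv_anti₀ (by norm_num) (by exact_mod_cast Nat.succ_le_succ hr)
    have hall : ∀ H ∈ 𝒞, H ≠ f H := by
      intro H hH hfixH
      obtain ⟨x, hx⟩ := Finset.card_pos.1 (by rw [(h𝒞 H hH).2]; norm_num : 0 < H.card)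
      have hxX := (h𝒞 H hH).1 hx
      have hterm := Finset.single_le_sum (hnonneg x) hH
      have hscore := hlt x hxX
      rw [hxscore x hxX, hpscore] at hscore
      rw [← hfixH, if_pos hx, (h𝒞 H hH).2] at hterm
      norm_num only [Nat.cast_ofNat] at hterm
      linarith
    have hle : 𝒞.card ≤ ((insert P 𝒞).filter fun v => v ≠ f v).card :=
      Finset.card_le_card fun H hH =>
        Finset.mem_filter.2 ⟨Finset.mem_insert_of_mem hH, hall H hH⟩
    omega
  have hpone : savCom ((insert P 𝒞).val.map f) {p} ≤ 1 := by
    rw [hpscore]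
    split_ifs with h
    · exact inv_le_one_of_one_le₀ (by exact_mod_cast Finset.card_pos.2 ⟨p, h⟩)
    · exact zero_le_one
  refine hasExactCover_of_cover ⟨hXcard, h𝒞card, h𝒞, hthree⟩
    (Finset.filter_subset (fun v => v ≠ f v) 𝒞) ?_ fun x hx => ?_
  · rw [Finset.filter_insert, if_pos hPchanged, Finset.card_insert_of_notMem] at hcount
    · omega
    · exact fun h => hP𝒞 (Finset.mem_filter.1 h).1
  · by_contra! hfix
    have hscore := (hlt x hx).trans_le hpone
    rw [hxscore x hx] at hscore
    refine hscore.not_ge ?_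
    calc (1 : ℚ) = ∑ H ∈ 𝒞 with x ∈ H, (1 / 3 : ℚ) := by
          rw [Finset.sum_const, hthree x hx]; norm_num
      _ = ∑ H ∈ 𝒞, if x ∈ H then (1 / 3 : ℚ) else 0 := Finset.sum_filter _ _
      _ ≤ _ := Finset.sum_le_sum fun H hH => by
          by_cases hxH : x ∈ H
          · have hfH : H = f H := by
              by_contra hne
              exact hfix H (Finset.mem_filter.2 ⟨hH, hne⟩) hxH
            rw [← hfH, if_pos hxH, if_pos hxH]
            norm_num [(h𝒞 H hH).2]
          · rw [if_neg hxH]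
            exact hnonneg x H hH

theorem exists_bribery_of_exactCover {X P : Finset α} {𝒞 : Finset (Finset α)} {κ r : ℕ}
    (hr : 3 ≤ r) (hR : IsRX3C X 𝒞 κ) (hP : Disjoint X P)
    (hPcard : P.card = r + 1) (hP𝒞 : P ∉ 𝒞) (hcover : HasExactCover X 𝒞) {p : α}
    (hp : p ∈ P) :
    ∃ f : Finset α → Finset α,
      (∀ v ∈ insert P 𝒞, f v ⊆ v ∧ (v \ f v).card ≤ r) ∧
      ((insert P 𝒞).filter fun v => v ≠ f v).card ≤ κ + 1 ∧
      ∀ x ∈ X, savCom ((insert P 𝒞).val.map f) {x} <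
        savCom ((insert P 𝒞).val.map f) {p} := by
  obtain ⟨𝒟, hsub, hcov⟩ := hcover
  have hcard := card_of_exactCover hR hsub hcov
  obtain ⟨-, -, h𝒞, hthree⟩ := hR
  let f : Finset α → Finset α := fun v => if v = P then {p} else if v ∈ 𝒟 then ∅ else v
  have hfP : f P = {p} := if_pos rfl
  have hf𝒞 : ∀ H ∈ 𝒞, f H = if H ∈ 𝒟 then ∅ else H := fun H hH =>
    if_neg fun h : H = P => hP𝒞 (h ▸ hH)
  refine ⟨f, fun v hv => ?_, ?_, fun x hx => ?_⟩
  · rcases Finset.mem_insert.1 hv with rfl | hv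
    · rw [hfP]
      refine ⟨by simpa using hp, ?_⟩
      rw [Finset.card_sdiff_of_subset (by simpa using hp)]
      simp [hPcard]
    · rw [hf𝒞 v hv]
      split_ifs
      · simpa [(h𝒞 v hv).2] using hr
      · simp
  · calc ((insert P 𝒞).filter fun v => v ≠ f v).card ≤ (insert P 𝒟).card := by
          refine Finset.card_le_card fun v hv => ?_
          obtain ⟨hv, hne⟩ := Finset.mem_filter.1 hv
          by_contra hnot
          simp only [Finset.mem_insert, not_or] at hnot
          exact hne (by simp [f, hnot.1, hnot.2])
      _ ≤ κ + 1 := hcard ▸ Finset.card_insert_le _ _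
  · have hxP : x ∉ f P := by
      rw [hfP, Finset.mem_singleton]
      rintro rfl
      exact Finset.disjoint_left.1 hP hx hp
    have hpscore : 1 ≤ savCom ((insert P 𝒞).val.map f) {p} := by
      rw [savCom_map_val_singleton, Finset.sum_insert hP𝒞, hfP]
      have : (0 : ℚ) ≤ ∑ H ∈ 𝒞, if p ∈ f H then ((f H).card : ℚ)⁻¹ else 0 :=
        Finset.sum_nonneg fun H _ => by positivity
      simpa using this
    refine lt_of_lt_of_le ?_ hpscore
    rw [savCom_map_val_singleton, Finset.sum_insert hP𝒞, if_neg hxP, zero_add]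
    calc (∑ H ∈ 𝒞, if x ∈ f H then ((f H).card : ℚ)⁻¹ else 0)
        = ∑ H ∈ 𝒞 with x ∈ f H, (1 / 3 : ℚ) := by
          rw [Finset.sum_filter]
          refine Finset.sum_congr rfl fun H hH => ?_
          rw [hf𝒞 H hH]
          by_cases hD : H ∈ 𝒟 <;> simp [hD, (h𝒞 H hH).2]
      _ < ∑ H ∈ 𝒞 with x ∈ H, (1 / 3 : ℚ) := by
          obtain ⟨K, hK⟩ := Finset.card_pos.1 ((hcov x hx).symm ▸ Nat.one_pos)
          obtain ⟨hKD, hxK⟩ := Finset.mem_filter.1 hK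
          refine Finset.sum_lt_sum_of_subset (i := K) (fun H hH => ?_) ?_ ?_ (by norm_num)
            fun _ _ _ => by norm_num
          · obtain ⟨hH, hxH⟩ := Finset.mem_filter.1 hH
            rw [hf𝒞 H hH] at hxH
            split_ifs at hxH
            · simp at hxH
            · exact Finset.mem_filter.2 ⟨hH, hxH⟩
          · exact Finset.mem_filter.2 ⟨hsub hKD, hxK⟩
          · simp [hf𝒞 K (hsub hKD), hKD]
      _ = 1 := by rw [Finset.sum_const, hthree x hx]; norm_num

/-- destructive bribery by vote deletion changes (at most `κ + 1` votes, each
losing at most `r ≥ 3` candidates) under SAV in the election built from an RX3C instance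
together with a set `P` of `r + 1` extra candidates succeeds iff the instance has an exact
cover. -/
theorem vdc_sav_rx3c
    (X : Finset α) (𝒞 : Finset (Finset α)) (κ r : ℕ)
    (hκ : 1 ≤ κ) (hr : 3 ≤ r) (hR : IsRX3C X 𝒞 κ)
    (P : Finset α) (hP : Disjoint X P) (hPcard : P.card = r + 1) :
    (∃ V' : Multiset (Finset α),
        VoteDeletionChanges (P ::ₘ 𝒞.val) V' (κ + 1) r ∧
        ∀ w, IsWinningCommittee (X ∪ P) 1 (savCom V') w → ∀ x ∈ X, x ∉ w)
    ↔ HasExactCover X 𝒞 := by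
  have hP𝒞 : P ∉ 𝒞 := fun h => by
    have := (hR.2.2.1 P h).2
    omega
  have hne : P.Nonempty := Finset.card_pos.1 (by omega)
  simp_rw [← Finset.insert_val_of_notMem hP𝒞, voteDeletionChanges_val_iff,
    forall_notMem_winning_singleton_iff hne]
  constructor
  · rintro ⟨_, ⟨f, rfl, hf, hcount⟩, p, hp, hlt⟩
    exact hasExactCover_of_score_lt hκ hr hR hP hPcard hP𝒞 (fun v hv => (hf v hv).1)
      hcount hp hlt
  · intro hcover
    obtain ⟨p, hp⟩ := hne
    obtain ⟨f, hf, hcount, hlt⟩ :=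
      exists_bribery_of_exactCover hr hR hP hPcard hP𝒞 hcover hp
    exact ⟨_, ⟨f, rfl, hf, hcount⟩, p, hp, hlt⟩

end ApprovalBribery
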